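/- arXiv:1709.00515 — 2 statements merged into one kernel-verified Lean document; each statement's English description precedes it below -/
import Mathlib

section
/- Let m, n ≥ 1, ε > 0, K > 0. Let b : ℝⁿ → ℝᵐ and Σ : ℝⁿ → (m×m real matrices) satisfy |b(X)| ≤ K and ‖Σ(X)‖ ≤ K for all X ∈ ℝⁿ. For X ∈ ℝⁿ, y ∈ ℝᵐ and t ≥ 0, let ν_t^{X,y} be the pushforward of the standard Gaussian measure γ on ℝᵐ under z ↦ b(X) + e^{−t}(y − b(X)) + √(ε(1 − e^{−2t})/2)·Σ(X)z (this is the time-t law of the Ornstein–Uhlenbeck process d𝔶 = (b(X) − 𝔶)dt + √ε·Σ(X)dW started at y), and let μ^{X,ε} be the pushforward of γ under z ↦ b(X) + √(ε/2)·Σ(X)z (the invariant measure of that process). Then there exist constants C > 0 (depending on ε, K and m but independent of X) and δ > 0 such that for every Lipschitz function φ : ℝᵐ → ℝ, every X ∈ ℝⁿ, y ∈ ℝᵐ and t ≥ 0: |∫ φ dν_t^{X,y} − ∫ φ dμ^{X,ε}| ≤ C·e^{−δt}·(1 + |y|)·[φ]_Lip. -/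
open MeasureTheory ProbabilityTheory

/-- The standard Gaussian measure on `ℝᵐ` (the `m`-fold product of the real Gaussian
measure with mean `0` and variance `1`), viewed as a measure on Euclidean space. -/
noncomputable def stdGaussian (m : ℕ) : Measure (EuclideanSpace ℝ (Fin m)) :=
  (Measure.pi fun _ : Fin m => gaussianReal 0 1).map
    ⇑(EuclideanSpace.equiv (Fin m) ℝ).symm

instance isGaussian_stdGaussian_euclideanSpace (m : ℕ) : IsGaussian (_root_.stdGaussian m) := by
  have h : _root_.stdGaussian m = ProbabilityTheory.stdGaussian (EuclideanSpace ℝ (Fin m)) :=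
    map_pi_eq_stdGaussian
  rw [h]
  infer_instance

/-- The norm has a finite first moment under the standard Gaussian measure. -/
lemma integrable_norm_stdGaussian (m : ℕ) :
    Integrable (fun z => ‖z‖) (_root_.stdGaussian m) :=
  IsGaussian.integrable_id.norm

/-- A Lipschitz function has a finite expectation under the law of an affine image of a standard
Gaussian vector. -/
lemma integrable_lipschitz_comp_affine_stdGaussian {m : ℕ} {k : NNReal}
    {φ : EuclideanSpace ℝ (Fin m) → ℝ} (hφ : LipschitzWith k φ) (a : EuclideanSpace ℝ (Fin m))
    (A : EuclideanSpace ℝ (Fin m) →L[ℝ] EuclideanSpace ℝ (Fin m)) :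
    Integrable (fun z => φ (a + A z)) (_root_.stdGaussian m) := by
  refine Integrable.mono' (g := fun z => |φ a| + k * (‖A‖ * ‖z‖))
    ((integrable_const _).add (((integrable_norm_stdGaussian m).const_mul _).const_mul _))
    (hφ.continuous.comp (by fun_prop)).aestronglyMeasurable (ae_of_all _ fun z => ?_)
  have h := hφ.norm_sub_le (a + A z) a
  rw [add_sub_cancel_left] at h
  have hA : k * ‖A z‖ ≤ k * (‖A‖ * ‖z‖) := by gcongr; exact A.le_opNorm z
  have htri := norm_add_le (φ a) (φ (a + A z) - φ a)
  rw [add_sub_cancel, Real.norm_eq_abs (φ a)] at htri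
  linarith

/-- Expectations of a Lipschitz function under two affine images of a standard Gaussian vector
differ by at most the cost of the synchronous coupling. -/
lemma abs_integral_map_affine_stdGaussian_sub_le {m : ℕ} {k : NNReal}
    {φ : EuclideanSpace ℝ (Fin m) → ℝ} (hφ : LipschitzWith k φ) (a a' : EuclideanSpace ℝ (Fin m))
    (A A' : EuclideanSpace ℝ (Fin m) →L[ℝ] EuclideanSpace ℝ (Fin m)) :
    |(∫ Y, φ Y ∂((_root_.stdGaussian m).map fun z => a + A z)) -
      ∫ Y, φ Y ∂((_root_.stdGaussian m).map fun z => a' + A' z)|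
      ≤ k * (‖a - a'‖ + ‖A - A'‖ * ∫ z, ‖z‖ ∂(_root_.stdGaussian m)) := by
  rw [integral_map (by fun_prop) hφ.continuous.aestronglyMeasurable,
    integral_map (by fun_prop) hφ.continuous.aestronglyMeasurable,
    ← integral_sub (integrable_lipschitz_comp_affine_stdGaussian hφ a A)
      (integrable_lipschitz_comp_affine_stdGaussian hφ a' A'), ← Real.norm_eq_abs]
  have hint := (integrable_norm_stdGaussian m).const_mul ‖A - A'‖
  calc _ ≤ ∫ z, k * (‖a - a'‖ + ‖A - A'‖ * ‖z‖) ∂(_root_.stdGaussian m) := by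
        refine norm_integral_le_of_norm_le (((integrable_const _).add hint).const_mul _)
          (ae_of_all _ fun z => (hφ.norm_sub_le _ _).trans ?_)
        gcongr
        calc ‖a + A z - (a' + A' z)‖ = ‖(a - a') + (A - A') z‖ := by
              rw [sub_apply]; abel_nf
          _ ≤ ‖a - a'‖ + ‖(A - A') z‖ := norm_add_le _ _
          _ ≤ _ := by gcongr; exact (A - A').le_opNorm z
    _ = _ := by
        rw [integral_const_mul, integral_add (integrable_const _) hint, integral_const_mul]
        simp

/-- The Ornstein–Uhlenbeck standard deviation converges exponentially fast to its limit. -/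
lemma abs_sqrt_ou_variance_sub_le {ε t : ℝ} (hε : 0 ≤ ε) (ht : 0 ≤ t) :
    |√(ε * (1 - Real.exp (-2 * t)) / 2) - √(ε / 2)| ≤ √(ε / 2) * Real.exp (-t) := by
  have he : Real.exp (-2 * t) = Real.exp (-t) ^ 2 := by
    rw [← Real.exp_nat_mul]; push_cast; ring_nf
  have h0 := (Real.exp_pos (-t)).le
  have h1 : Real.exp (-t) ≤ 1 := Real.exp_le_one_iff.2 (by linarith)
  have hs : 1 - Real.exp (-t) ≤ √(1 - Real.exp (-t) ^ 2) :=
    Real.le_sqrt_of_sq_le (by nlinarith)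
  have hs1 : √(1 - Real.exp (-t) ^ 2) ≤ 1 := Real.sqrt_le_one.2 (by nlinarith)
  rw [he, show ε * (1 - Real.exp (-t) ^ 2) / 2 = ε / 2 * (1 - Real.exp (-t) ^ 2) by ring,
    Real.sqrt_mul (by positivity), abs_of_nonpos
      (sub_nonpos.2 (mul_le_of_le_one_right (Real.sqrt_nonneg _) hs1))]
  nlinarith [Real.sqrt_nonneg (ε / 2)]

/-- **Exponential mixing estimate (3.2) of Lemma 2.2.**
Let `|b X| ≤ K` and `‖S X‖ ≤ K`.  For `X, y, t ≥ 0`, let `ν_t^{X,y}` be the pushforward of the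
standard Gaussian `γ` on `ℝᵐ` under `z ↦ b X + e^{−t}(y − b X) + √(ε(1 − e^{−2t})/2) • S X z`
(the time-`t` law of the frozen-`X` Ornstein–Uhlenbeck process started at `y`), and let
`μ^{X,ε}` be the pushforward of `γ` under `z ↦ b X + √(ε/2) • S X z` (the invariant measure).
Then there are constants `C > 0` (depending on `ε`, `K`, `m` but independent of `X`) and
`δ > 0` such that for every Lipschitz `φ`, all `X`, `y` and `t ≥ 0`:
`|∫ φ dν_t^{X,y} − ∫ φ dμ^{X,ε}| ≤ C e^{−δ t} (1 + |y|) [φ]_Lip`. -/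
theorem stmt_3 (m n : ℕ) (hm : 1 ≤ m) (hn : 1 ≤ n) (ε K : ℝ) (hε : 0 < ε) (hK : 0 < K) :
    ∃ C > (0 : ℝ), ∃ δ > (0 : ℝ),
      ∀ (b : EuclideanSpace ℝ (Fin n) → EuclideanSpace ℝ (Fin m))
        (S : EuclideanSpace ℝ (Fin n) →
          (EuclideanSpace ℝ (Fin m) →L[ℝ] EuclideanSpace ℝ (Fin m))),
        (∀ X, ‖b X‖ ≤ K) → (∀ X, ‖S X‖ ≤ K) →
      ∀ (Kφ : NNReal) (φ : EuclideanSpace ℝ (Fin m) → ℝ), LipschitzWith Kφ φ →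
      ∀ (X : EuclideanSpace ℝ (Fin n)) (y : EuclideanSpace ℝ (Fin m)) (t : ℝ), 0 ≤ t →
        |(∫ Y, φ Y ∂((stdGaussian m).map
            (fun z => b X + Real.exp (-t) • (y - b X) +
              Real.sqrt (ε * (1 - Real.exp (-2 * t)) / 2) • S X z))) -
         (∫ Y, φ Y ∂((stdGaussian m).map
            (fun z => b X + Real.sqrt (ε / 2) • S X z)))|
          ≤ C * Real.exp (-δ * t) * (1 + ‖y‖) * (Kφ : ℝ) := by
  set M := ∫ z, ‖z‖ ∂(_root_.stdGaussian m)
  have hM : 0 ≤ M := integral_nonneg fun z => norm_nonneg z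
  refine ⟨1 + K + √(ε / 2) * K * M, by positivity, 1, one_pos, ?_⟩
  intro b S hb hS Kφ φ hφ X y t ht
  have hdiff := abs_integral_map_affine_stdGaussian_sub_le hφ
    (b X + Real.exp (-t) • (y - b X)) (b X)
    (√(ε * (1 - Real.exp (-2 * t)) / 2) • S X) (√(ε / 2) • S X)
  refine hdiff.trans ?_
  have hmean : ‖b X + Real.exp (-t) • (y - b X) - b X‖ ≤ Real.exp (-t) * (‖y‖ + K) := by
    rw [add_sub_cancel_left, norm_smul, Real.norm_of_nonneg (Real.exp_pos _).le]
    gcongr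
    exact (norm_sub_le _ _).trans (by gcongr; exact hb X)
  have hdev : ‖√(ε * (1 - Real.exp (-2 * t)) / 2) • S X - √(ε / 2) • S X‖
      ≤ √(ε / 2) * Real.exp (-t) * K := by
    rw [← sub_smul _ _ (S X), norm_smul, Real.norm_eq_abs]
    gcongr
    · exact abs_sqrt_ou_variance_sub_le hε.le ht
    · exact hS X
  calc _ ≤ Kφ * (Real.exp (-t) * (‖y‖ + K) + √(ε / 2) * Real.exp (-t) * K * M) := by gcongr
    _ = (‖y‖ + K + √(ε / 2) * K * M) * (Kφ * Real.exp (-t)) := by ring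
    _ ≤ ((1 + K + √(ε / 2) * K * M) * (1 + ‖y‖)) * (Kφ * Real.exp (-t)) := by
        gcongr
        have : 0 ≤ (K + √(ε / 2) * K * M) * ‖y‖ := by positivity
        linarith
    _ = _ := by rw [neg_one_mul]; ring
end

section
/- Let m ≥ 1, p ≥ 2 a real number, λ > 0 and K ≥ 0. Suppose Λ : [0,∞) → ℝᵐ is differentiable and B : [0,∞) → ℝᵐ is continuous with |B(t)| ≤ K for all t ≥ 0, and Λ satisfies Λ'(t) = −λ·(Λ(t) + B(t)) for all t ≥ 0. Then for all t ≥ 0: |Λ(t)|ᵖ ≤ e^{−λt}·|Λ(0)|ᵖ + Kᵖ. -/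
/-- A solution of `Λ' = -λ (Λ + B)` with `‖B‖ ≤ K` is bounded in norm by the convex combination
of `‖Λ 0‖` and `K` with weights `e^{-λ t}` and `1 - e^{-λ t}`. -/
theorem norm_le_of_hasDerivWithinAt_neg_smul_add {E : Type*} [NormedAddCommGroup E]
    [NormedSpace ℝ E] {lam K : ℝ} (hlam : 0 ≤ lam) {Λ B : ℝ → E}
    (hB : ∀ t : ℝ, 0 ≤ t → ‖B t‖ ≤ K)
    (hΛ : ∀ t : ℝ, 0 ≤ t →
      HasDerivWithinAt Λ (-lam • (Λ t + B t)) (Set.Ici (0 : ℝ)) t) {t : ℝ} (ht : 0 ≤ t) :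
    ‖Λ t‖ ≤ Real.exp (-lam * t) * ‖Λ 0‖ + (1 - Real.exp (-lam * t)) * K := by
  have hexp (s : ℝ) : HasDerivAt (fun s => Real.exp (lam * s)) (Real.exp (lam * s) * lam) s := by
    simpa using ((hasDerivAt_id s).const_mul lam).exp
  have hderiv (s : ℝ) (hs : 0 ≤ s) : HasDerivWithinAt (fun s => Real.exp (lam * s) • Λ s)
      (-(Real.exp (lam * s) * lam) • B s) (Set.Ici 0) s := by
    refine ((hexp s).hasDerivWithinAt.smul (hΛ s hs)).congr_deriv ?_
    module
  have key : ‖Real.exp (lam * t) • Λ t‖ ≤ ‖Λ 0‖ + K * (Real.exp (lam * t) - 1) := by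
    refine image_norm_le_of_norm_deriv_right_le_deriv_boundary
      (f := fun s => Real.exp (lam * s) • Λ s)
      (f' := fun s => -(Real.exp (lam * s) * lam) • B s)
      (B := fun s => ‖Λ 0‖ + K * (Real.exp (lam * s) - 1))
      (B' := fun s => K * (Real.exp (lam * s) * lam)) (a := 0) (b := t)
      (fun s hs => (hderiv s hs.1).continuousWithinAt.mono Set.Icc_subset_Ici_self)
      (fun s hs => (hderiv s hs.1).mono (Set.Ici_subset_Ici.2 hs.1)) (by simp)
      (fun s => (((hexp s).sub_const 1).const_mul K).const_add _) ?_ (Set.right_mem_Icc.2 ht)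
    intro s hs
    have hnonneg : 0 ≤ Real.exp (lam * s) * lam := by positivity
    rw [norm_smul, norm_neg, Real.norm_of_nonneg hnonneg, mul_comm K]
    exact mul_le_mul_of_nonneg_left (hB s hs.1) hnonneg
  rw [norm_smul, Real.norm_of_nonneg (Real.exp_pos _).le] at key
  have hinv : Real.exp (-lam * t) * Real.exp (lam * t) = 1 := by
    rw [← Real.exp_add]
    simp
  calc ‖Λ t‖ = Real.exp (-lam * t) * (Real.exp (lam * t) * ‖Λ t‖) := by
        rw [← mul_assoc, hinv, one_mul]
    _ ≤ Real.exp (-lam * t) * (‖Λ 0‖ + K * (Real.exp (lam * t) - 1)) :=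
        mul_le_mul_of_nonneg_left key (Real.exp_pos _).le
    _ = Real.exp (-lam * t) * ‖Λ 0‖ + (1 - Real.exp (-lam * t)) * K := by
        linear_combination K * hinv

/-- **Deterministic `p`-th power decay estimate in the proof of Lemma 3.2.**
Let `p ≥ 2` be a real number.  Suppose `Λ : [0,∞) → ℝᵐ` is differentiable,
`B : [0,∞) → ℝᵐ` is continuous with `|B t| ≤ K` for all `t ≥ 0`, and
`Λ' t = −λ (Λ t + B t)` on `[0,∞)`, where `λ > 0`.  Then for all `t ≥ 0`:
`|Λ t|ᵖ ≤ e^{−λ t} |Λ 0|ᵖ + Kᵖ` (real powers). -/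
theorem stmt_8 (m : ℕ) (hm : 1 ≤ m) (p : ℝ) (hp : 2 ≤ p)
    (lam K : ℝ) (hlam : 0 < lam) (hK : 0 ≤ K)
    (Λ B : ℝ → EuclideanSpace ℝ (Fin m))
    (hB : ContinuousOn B (Set.Ici (0 : ℝ)))
    (hBbd : ∀ t : ℝ, 0 ≤ t → ‖B t‖ ≤ K)
    (hΛ : ∀ t : ℝ, 0 ≤ t →
      HasDerivWithinAt Λ (-lam • (Λ t + B t)) (Set.Ici (0 : ℝ)) t) :
    ∀ t : ℝ, 0 ≤ t →
      ‖Λ t‖ ^ p ≤ Real.exp (-lam * t) * ‖Λ 0‖ ^ p + K ^ p := by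
  intro t ht
  have hle : Real.exp (-lam * t) ≤ 1 := Real.exp_le_one_iff.2 (by nlinarith)
  have hconv := (convexOn_rpow (show 1 ≤ p by linarith)).2 (norm_nonneg (Λ 0)) hK
    (Real.exp_pos (-lam * t)).le (sub_nonneg.2 hle) (add_sub_cancel _ _)
  simp only [smul_eq_mul] at hconv
  calc ‖Λ t‖ ^ p
      ≤ (Real.exp (-lam * t) * ‖Λ 0‖ + (1 - Real.exp (-lam * t)) * K) ^ p :=
        Real.rpow_le_rpow (norm_nonneg _)
          (norm_le_of_hasDerivWithinAt_neg_smul_add hlam.le hBbd hΛ ht) (by linarith)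
    _ ≤ Real.exp (-lam * t) * ‖Λ 0‖ ^ p + (1 - Real.exp (-lam * t)) * K ^ p := hconv
    _ ≤ Real.exp (-lam * t) * ‖Λ 0‖ ^ p + K ^ p := by
        gcongr
        exact mul_le_of_le_one_left (Real.rpow_nonneg hK p)
          (sub_le_self _ (Real.exp_pos _).le)
end
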